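/- Let K be an algebraically closed field, let d ≥ 1, and let L ⊆ Sym^d be a K-subspace with 3 ≤ finrank_K L which has degree d and arithmetic genus 0 (i.e. finrank_K(L^k) = d·k + 1 for all sufficiently large k). Then for every Q = (α, β) ∈ K × K with (α, β) ≠ (0, 0), the value semigroup S(L, Q) is finitely generated; that is, R(L) is homogeneously Khovanskii-finite. (Second part of Theorem 4.11 of the paper; equivalently, one direction of Theorem 1.3: the affine cone over a smooth projective rational curve is homogeneously Khovanskii-finite.) -/

import Mathlib

open MvPolynomial Filter

noncomputable section

variable {K : Type} [Field K]

/-- The linear form `β·s − α·t` in `K[s,t]`, cutting out the point `Q = (α : β)` of `ℙ¹`. -/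
def lform (α β : K) : MvPolynomial (Fin 2) K := C β * X 0 - C α * X 1

/-- The value semigroup `S(L, Q) = {(k, ord_Q f) : f ∈ L^k, f ≠ 0}` of the homogeneous
valuation `ν_Q` on `R(L) = ⨁ₖ L^k`, where `ord_Q f` is the largest `e` such that
`(β·s − α·t)^e` divides `f`. -/
def curveValueSemigroup (L : Submodule K (MvPolynomial (Fin 2) K)) (α β : K) :
    AddSubmonoid (ℤ × ℤ) :=
  AddSubmonoid.closure
    {p | ∃ (k e : ℕ) (f : MvPolynomial (Fin 2) K), f ∈ L ^ k ∧ f ≠ 0 ∧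
      (lform α β) ^ e ∣ f ∧ ¬ (lform α β) ^ (e + 1) ∣ f ∧ p = ((k : ℤ), (e : ℤ))}

theorem homogeneousSubmodule_fin_two_le_span (n : ℕ) :
    homogeneousSubmodule (Fin 2) K n ≤ Submodule.span K
      (Set.range fun i : Fin (n + 1) =>
        (X 0 ^ (i : ℕ) * X 1 ^ (n - i) : MvPolynomial (Fin 2) K)) := by
  intro f hf
  rw [mem_homogeneousSubmodule] at hf
  rw [f.as_sum]
  refine Submodule.sum_mem _ fun m hm => ?_
  have hdeg : m 0 + m 1 = n := by
    have h := hf (mem_support_iff.mp hm)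
    simpa [Finsupp.weight_apply, Finsupp.sum_fintype, Fin.sum_univ_two] using h
  have hmon : monomial m (coeff m f) = coeff m f • (X 0 ^ m 0 * X 1 ^ (n - m 0)) := by
    rw [monomial_eq, Finsupp.prod_fintype _ _ (fun _ => pow_zero _), Fin.prod_univ_two,
      show n - m 0 = m 1 by omega, smul_eq_C_mul]
  rw [hmon]
  exact Submodule.smul_mem _ _ (Submodule.subset_span ⟨⟨m 0, by omega⟩, rfl⟩)

theorem pow_le_homogeneousSubmodule {L : Submodule K (MvPolynomial (Fin 2) K)} {d : ℕ}
    (hL : L ≤ homogeneousSubmodule (Fin 2) K d) (k : ℕ) :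
    L ^ k ≤ homogeneousSubmodule (Fin 2) K (d * k) := by
  induction k with
  | zero =>
    rw [pow_zero, Submodule.one_le]
    exact isHomogeneous_one _ _
  | succ k ih =>
    rw [pow_succ, Submodule.mul_le]
    intro f hf g hg
    exact (ih hf).mul (hL hg)

/-- A subspace of `Sym^n` of dimension `n + 1` is all of `Sym^n`. -/
theorem eq_homogeneousSubmodule_of_finrank {M : Submodule K (MvPolynomial (Fin 2) K)} {n : ℕ}
    (hM : M ≤ homogeneousSubmodule (Fin 2) K n) (hrank : Module.finrank K M = n + 1) :
    M = homogeneousSubmodule (Fin 2) K n := by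
  have hspan := homogeneousSubmodule_fin_two_le_span (K := K) n
  have hfin := FiniteDimensional.span_of_finite K (Set.finite_range
    fun i : Fin (n + 1) => (X 0 ^ (i : ℕ) * X 1 ^ (n - i) : MvPolynomial (Fin 2) K))
  have : FiniteDimensional K (homogeneousSubmodule (Fin 2) K n) :=
    Submodule.finiteDimensional_of_le hspan
  refine Submodule.eq_of_le_of_finrank_le hM ?_
  rw [hrank]
  exact (Submodule.finrank_mono hspan).trans
    ((finrank_range_le_card _).trans_eq (Fintype.card_fin _))

theorem isHomogeneous_lform (α β : K) : (lform α β).IsHomogeneous 1 :=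
  (by simpa using (isHomogeneous_C (Fin 2) β).mul (isHomogeneous_X K 0) :
    (C β * X 0 : MvPolynomial (Fin 2) K).IsHomogeneous 1).sub
  (by simpa using (isHomogeneous_C (Fin 2) α).mul (isHomogeneous_X K 1))

theorem le_of_lform_pow_dvd {α β : K} {n e : ℕ} {f : MvPolynomial (Fin 2) K}
    (hf : f.IsHomogeneous n) (hf0 : f ≠ 0) (hdvd : lform α β ^ e ∣ f) : e ≤ n := by
  obtain ⟨g, rfl⟩ := hdvd
  have h := totalDegree_mul_of_isDomain (left_ne_zero_of_mul hf0) (right_ne_zero_of_mul hf0)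
  have hpow : (lform α β ^ e).IsHomogeneous e := by
    simpa using (isHomogeneous_lform α β).pow e
  rw [hf.totalDegree hf0, hpow.totalDegree (left_ne_zero_of_mul hf0)] at h
  omega

/-- Every order `e ≤ n` at a point of `ℙ¹` is attained by a form of degree `n`. -/
theorem exists_isHomogeneous_lform_order {α β : K} (hQ : (α, β) ≠ ((0 : K), (0 : K)))
    {n e : ℕ} (he : e ≤ n) : ∃ f : MvPolynomial (Fin 2) K, f.IsHomogeneous n ∧ f ≠ 0 ∧
      lform α β ^ e ∣ f ∧ ¬ lform α β ^ (e + 1) ∣ f := by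
  obtain ⟨i, hi⟩ : ∃ i, (![α, β] : Fin 2 → K) i ≠ 0 := by
    by_contra! h
    exact hQ (Prod.ext (h 0) (h 1))
  have hl0 : lform α β ≠ 0 := by
    intro h
    have hβ := congrArg (eval ![1, 0]) h
    have hα := congrArg (eval ![0, 1]) h
    simp [lform] at hα hβ
    exact hQ (Prod.ext hα hβ)
  refine ⟨lform α β ^ e * X i ^ (n - e), ?_, mul_ne_zero (pow_ne_zero _ hl0)
    (pow_ne_zero _ (X_ne_zero i)), dvd_mul_right _ _, ?_⟩
  · have h := ((isHomogeneous_lform α β).pow e).mul ((isHomogeneous_X K i).pow (n - e))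
    rwa [one_mul, one_mul, Nat.add_sub_cancel' he] at h
  · rw [pow_succ, mul_dvd_mul_iff_left (pow_ne_zero _ hl0)]
    rintro ⟨g, hg⟩
    have h := congrArg (eval ![α, β]) hg
    have hl : eval ![α, β] (lform α β) = 0 := by simp [lform, mul_comm]
    rw [map_mul, hl, zero_mul, map_pow, eval_X] at h
    exact pow_ne_zero _ hi h

/-- A submonoid generated by lattice points of the cone `0 ≤ e ≤ d * k` that contains all points
of the cone with `k ≥ N` is finitely generated. -/
theorem closure_fg_of_cone {d N : ℕ} {T : Set (ℤ × ℤ)}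
    (hT : ∀ p ∈ T, ∃ k e : ℕ, e ≤ d * k ∧ p = ((k : ℤ), (e : ℤ)))
    (hN : ∀ k e : ℕ, N ≤ k → e ≤ d * k → ((k : ℤ), (e : ℤ)) ∈ T) :
    (AddSubmonoid.closure T).FG := by
  set M := N + 1
  set B : Set (ℤ × ℤ) := T ∩ {p | p.1 < 2 * M}
  have hB : B.Finite := by
    refine (Set.finite_Icc ((0, 0) : ℤ × ℤ) (2 * M, d * (2 * M))).subset ?_
    rintro p ⟨hp, hlt⟩
    obtain ⟨k, e, he, rfl⟩ := hT p hp
    have hk : (k : ℤ) ≤ 2 * M := le_of_lt hlt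
    have he' : (e : ℤ) ≤ d * k := by exact_mod_cast he
    exact ⟨⟨by simp, by simp⟩, hk, he'.trans (mul_le_mul_of_nonneg_left hk (by positivity))⟩
  rw [AddSubmonoid.fg_iff]
  refine ⟨B, le_antisymm (AddSubmonoid.closure_mono Set.inter_subset_left) ?_, hB⟩
  rw [AddSubmonoid.closure_le]
  suffices h : ∀ k e : ℕ, e ≤ d * k → ((k : ℤ), (e : ℤ)) ∈ T →
      ((k : ℤ), (e : ℤ)) ∈ AddSubmonoid.closure B by
    intro p hp
    obtain ⟨k, e, he, rfl⟩ := hT p hp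
    exact h k e he hp
  intro k
  induction k using Nat.strong_induction_on with
  | _ k ih =>
    intro e he hp
    by_cases hk : k < 2 * M
    · exact AddSubmonoid.subset_closure ⟨hp, show (k : ℤ) < 2 * M by exact_mod_cast hk⟩
    · have hsplit : d * k = d * M + d * (k - M) := by rw [← mul_add]; congr 1; omega
      have hmem : ∀ j a : ℕ, N ≤ j → j < k → a ≤ d * j →
          ((j : ℤ), (a : ℤ)) ∈ AddSubmonoid.closure B :=
        fun j a hj hjk ha => ih j hjk a ha (hN j a hj ha)
      have hsum := add_mem
        (hmem M (min e (d * M)) (by omega) (by omega) (min_le_right _ _))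
        (hmem (k - M) (e - min e (d * M)) (by omega) (by omega) (by omega))
      convert hsum using 1
      ext <;> simp only [Prod.fst_add, Prod.snd_add] <;> omega

/-- **Theorem 4.11, second part.** Let `L ⊆ Sym^d` be a subspace of dimension at least `3`,
of degree `d` and arithmetic genus `0`. Then `R(L)` is homogeneously Khovanskii-finite: for
every point `Q = (α : β)` of `ℙ¹`, the value semigroup `S(L, Q)` is finitely generated. -/
theorem khovanskiiFinite_of_genus_zero [IsAlgClosed K] (d : ℕ) (hd : 1 ≤ d)
    (L : Submodule K (MvPolynomial (Fin 2) K))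
    (hL : L ≤ MvPolynomial.homogeneousSubmodule (Fin 2) K d)
    (hdim : 3 ≤ Module.finrank K ↥L)
    -- `L` has degree `d` and arithmetic genus `0`
    (hdeg : ∀ᶠ k : ℕ in atTop, (Module.finrank K ↥(L ^ k) : ℤ) = d * k + 1) :
    ∀ α β : K, (α, β) ≠ ((0 : K), (0 : K)) → (curveValueSemigroup L α β).FG := by
  intro α β hQ
  obtain ⟨N, hN⟩ := eventually_atTop.mp hdeg
  refine closure_fg_of_cone (d := d) (N := N) ?_ ?_
  · rintro p ⟨k, e, f, hf, hf0, hdvd, -, rfl⟩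
    exact ⟨k, e, le_of_lform_pow_dvd (pow_le_homogeneousSubmodule hL k hf) hf0 hdvd, rfl⟩
  · intro k e hk he
    obtain ⟨f, hf, hf0, hdvd, hndvd⟩ := exists_isHomogeneous_lform_order hQ he
    have hLk : L ^ k = homogeneousSubmodule (Fin 2) K (d * k) :=
      eq_homogeneousSubmodule_of_finrank (pow_le_homogeneousSubmodule hL k)
        (by exact_mod_cast hN k hk)
    exact ⟨k, e, f, hLk ▸ hf, hf0, hdvd, hndvd, rfl⟩

end
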